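/- arXiv:1801.07590 — 2 statements merged into one kernel-verified Lean document; each statement's English description precedes it below -/
import Mathlib

section
/- Let d ≥ 1 and let v : ℝ^d × ℝ^d → ℝ be Carathéodory, ℤ^d-periodic in its second variable, and such that x ↦ sup_{y ∈ [0,1]^d} |v(x,y)| is integrable on ℝ^d. Then ∫_{ℝ^d} ∫_Y |v(S_ε(x,y), y) − v(x,y)| dy dx → 0 as ε → 0⁺. -/
open MeasureTheory Set Filter Topology

lemma meas_of_dist {X E : Type*} [MeasurableSpace X] [PseudoMetricSpace E]
    [SecondCountableTopology E] [MeasurableSpace E] [BorelSpace E] (f : X → E)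
    (h : ∀ g, Measurable fun x => dist (f x) g) : Measurable f := by
  have hb : TopologicalSpace.IsTopologicalBasis
      {s : Set E | ∃ g : E, ∃ r : ℝ, s = Metric.ball g r} := by
    refine TopologicalSpace.isTopologicalBasis_of_isOpen_of_nhds ?_ ?_
    · rintro _ ⟨g, r, rfl⟩
      exact Metric.isOpen_ball
    · intro a u ha hu
      obtain ⟨r, hr, hs⟩ := Metric.isOpen_iff.1 hu a ha
      exact ⟨_, ⟨a, r, rfl⟩, Metric.mem_ball_self hr, hs⟩
  rw [BorelSpace.measurable_eq (α := E), borel_eq_generateFrom_of_subbasis hb.eq_generateFrom]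
  apply measurable_generateFrom
  rintro _ ⟨g, r, rfl⟩
  exact measurableSet_lt (h g) measurable_const

lemma meas_of_eval {X K : Type*} [MeasurableSpace X] [TopologicalSpace K] [CompactSpace K]
    [TopologicalSpace.SeparableSpace K] [Nonempty K]
    [MeasurableSpace C(K, ℝ)] [BorelSpace C(K, ℝ)] [SecondCountableTopology C(K, ℝ)]
    (f : X → C(K, ℝ)) (h : ∀ y, Measurable fun x => f x y) : Measurable f := by
  apply meas_of_dist
  intro g
  apply measurable_of_Iic
  intro r
  by_cases hr : 0 ≤ r
  · have : (fun x => dist (f x) g) ⁻¹' Iic r =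
        ⋂ n : ℕ, {x | dist (f x (TopologicalSpace.denseSeq K n))
          (g (TopologicalSpace.denseSeq K n)) ≤ r} := by
      ext x
      simp only [mem_preimage, mem_Iic, mem_iInter, mem_ofPred_eq]
      rw [ContinuousMap.dist_le hr]
      refine ⟨fun H n => H _, fun H y => ?_⟩
      refine (TopologicalSpace.denseRange_denseSeq K).induction_on
        (p := fun y => dist (f x y) (g y) ≤ r) y ?_ H
      exact isClosed_le (by fun_prop) continuous_const
    rw [this]
    refine MeasurableSet.iInter fun n => measurableSet_le ?_ measurable_const
    exact (h _).dist measurable_const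
  · have : (fun x => dist (f x) g) ⁻¹' Iic r = ∅ := by
      ext x
      simp only [mem_preimage, mem_Iic, mem_empty_iff_false, iff_false]
      intro H
      exact hr (dist_nonneg.trans H)
    rw [this]; exact MeasurableSet.empty

/-- scaling map -/
noncomputable def SS {d : ℕ} (ε : ℝ) (x y : Fin d → ℝ) : Fin d → ℝ := fun i => ε * ((⌊x i / ε⌋ : ℝ) + y i)

lemma SS_meas {d : ℕ} (ε : ℝ) : Measurable fun p : (Fin d → ℝ) × (Fin d → ℝ) => SS ε p.1 p.2 := by
  unfold SS
  refine measurable_pi_lambda _ fun i => ?_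
  have : Measurable fun p : (Fin d → ℝ) × (Fin d → ℝ) => (⌊p.1 i / ε⌋ : ℝ) :=
    (measurable_from_top (f := fun n : ℤ => (n : ℝ))).comp
      (Int.measurable_floor.comp (by fun_prop))
  fun_prop

lemma affine_lintegral {d : ℕ} {ε : ℝ} (hε : 0 < ε) (k : Fin d → ℝ) (G : (Fin d → ℝ) → ENNReal)
    (hG : Measurable G) :
    ENNReal.ofReal (ε ^ d) * ∫⁻ y : Fin d → ℝ, G (fun i => ε * (k i + y i)) = ∫⁻ z, G z := by
  have h1 : ∫⁻ y : Fin d → ℝ, G (fun i => ε * (k i + y i)) = ∫⁻ y : Fin d → ℝ, G (ε • y) :=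
    lintegral_add_left_eq_self (fun y => G (ε • y)) k
  have h2 : ∫⁻ y : Fin d → ℝ, G (ε • y) = ∫⁻ z, G z ∂(Measure.map (ε • ·) (volume : Measure (Fin d → ℝ))) := by
    rw [lintegral_map hG (by fun_prop)]
  rw [h1, h2, Measure.map_addHaar_smul _ hε.ne', lintegral_smul_measure, smul_eq_mul, ← mul_assoc,
    ← ENNReal.ofReal_mul (by positivity), abs_of_pos (by positivity)]
  simp [hε.ne']

lemma affine_null {d : ℕ} {ε : ℝ} (hε : 0 < ε) (k : Fin d → ℝ) {N : Set (Fin d → ℝ)}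
    (hN : MeasurableSet N) (h0 : volume N = 0) :
    ∀ᵐ y : Fin d → ℝ, (fun i => ε * (k i + y i)) ∉ N := by
  have := affine_lintegral hε k (N.indicator 1) (measurable_one.indicator hN)
  rw [lintegral_indicator_one hN, h0, mul_eq_zero] at this
  have h : ∫⁻ y : Fin d → ℝ, N.indicator 1 (fun i => ε * (k i + y i)) = (0 : ENNReal) := by
    rcases this with h | h
    · simp at h
      exact absurd h (not_le.2 (by positivity))
    · exact h
  have hmm : Measurable fun y : Fin d → ℝ =>
      N.indicator (1 : (Fin d → ℝ) → ENNReal) (fun i => ε * (k i + y i)) :=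
    (measurable_one.indicator hN).comp (by fun_prop)
  rw [lintegral_eq_zero_iff hmm] at h
  filter_upwards [h] with y hy hn
  simp [hn] at hy

lemma unfold_le {d : ℕ} {ε : ℝ} (hε : 0 < ε) (G : (Fin d → ℝ) → ENNReal)
    (hG : Measurable G) :
    ∫⁻ x, ∫⁻ y in univ.pi fun _ : Fin d => Ioo (0 : ℝ) 1, G (SS ε x y) ≤ ∫⁻ z, G z := by
  set c : (Fin d → ℤ) → Set (Fin d → ℝ) := fun k =>
    univ.pi fun i => Ico (ε * k i) (ε * k i + ε) with hc
  have hfl : ∀ k x, x ∈ c k ↔ (fun i => ⌊x i / ε⌋) = k := by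
    intro k x
    simp only [hc, mem_univ_pi, mem_Ico, funext_iff, Int.floor_eq_iff, le_div_iff₀ hε,
      div_lt_iff₀ hε]
    refine forall_congr' fun i => ?_
    rw [mul_comm, add_mul, one_mul]
  have hm : ∀ k, MeasurableSet (c k) := fun k => MeasurableSet.univ_pi fun i => measurableSet_Ico
  have hdj : Pairwise (Function.onFun Disjoint c) := by
    intro k l hkl
    refine Set.disjoint_left.2 fun x hx hx' => hkl ?_
    rw [← (hfl _ _).1 hx, ← (hfl _ _).1 hx']
  have hU : ⋃ k, c k = univ := by
    ext x; simp only [mem_iUnion, mem_univ, iff_true]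
    exact ⟨_, (hfl _ _).2 rfl⟩
  have key : ∀ F : (Fin d → ℝ) → ENNReal, ∫⁻ x, F x = ∑' k, ∫⁻ x in c k, F x := by
    intro F
    rw [← lintegral_iUnion hm hdj, hU, Measure.restrict_univ]
  rw [key, key G]
  refine ENNReal.tsum_le_tsum fun k => ?_
  calc ∫⁻ x in c k, ∫⁻ y in univ.pi fun _ : Fin d => Ioo (0 : ℝ) 1, G (SS ε x y)
      = ∫⁻ x in c k, ∫⁻ y in univ.pi fun _ : Fin d => Ioo (0 : ℝ) 1,
          G (fun i => ε * ((k i : ℝ) + y i)) := by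
        refine setLIntegral_congr_fun (hm k) fun x hx => ?_
        have := (hfl _ _).1 hx
        simp only [← this]
        rfl
    _ = ENNReal.ofReal (ε ^ d) * ∫⁻ y in univ.pi fun _ : Fin d => Ioo (0 : ℝ) 1,
          G (fun i => ε * ((k i : ℝ) + y i)) := by
        rw [setLIntegral_const, mul_comm]
        congr 1
        simp [hc, Real.volume_pi_Ico, volume_pi_pi, ENNReal.ofReal_pow hε.le]
    _ ≤ ENNReal.ofReal (ε ^ d) * ∫⁻ y : Fin d → ℝ, (c k).indicator G
          (fun i => ε * ((k i : ℝ) + y i)) := by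
        refine mul_le_mul_right ?_ _
        rw [← lintegral_indicator (MeasurableSet.univ_pi fun i => measurableSet_Ioo)]
        refine lintegral_mono fun y => ?_
        by_cases hy : y ∈ univ.pi fun _ : Fin d => Ioo (0 : ℝ) 1
        · rw [indicator_of_mem hy, indicator_of_mem]
          simp only [hc, mem_univ_pi, mem_Ico, mem_Ioo] at hy ⊢
          intro i
          have := hy i
          constructor <;> nlinarith
        · rw [indicator_of_notMem hy]; exact zero_le
    _ = ∫⁻ x in c k, G x := by
        rw [affine_lintegral hε _ _ (hG.indicator (hm k)), lintegral_indicator (hm k)]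

lemma SS_dist {d : ℕ} {ε : ℝ} (hε : 0 < ε) (x y : Fin d → ℝ)
    (hy : y ∈ univ.pi fun _ : Fin d => Ioo (0 : ℝ) 1) : dist (SS ε x y) x ≤ ε := by
  rw [dist_pi_le_iff hε.le]
  intro i
  have h1 := Int.floor_le (x i / ε)
  have h2 := Int.lt_floor_add_one (x i / ε)
  rw [le_div_iff₀ hε] at h1
  rw [div_lt_iff₀ hε] at h2
  have := hy i (mem_univ i)
  simp only [mem_Ioo] at this
  rw [Real.dist_eq, abs_le, SS]
  constructor <;> nlinarith

lemma conv_cpt {d : ℕ} {E : Type*} [NormedAddCommGroup E] (h : (Fin d → ℝ) → E)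
    (hc : Continuous h) (hs : HasCompactSupport h) {η : ENNReal} (hη : η ≠ 0) :
    ∀ᶠ ε in 𝓝[>] (0:ℝ), ∫⁻ x, ∫⁻ y in univ.pi fun _ : Fin d => Ioo (0 : ℝ) 1,
      ‖h (SS ε x y) - h x‖ₑ ≤ η := by
  set K := Metric.cthickening 1 (tsupport h) with hK
  have hKc : IsCompact K := hs.isCompact.cthickening
  have hKv : volume K ≠ ⊤ := hKc.measure_lt_top.ne
  obtain ⟨r, hr, hrK⟩ : ∃ r : ℝ, 0 < r ∧ ENNReal.ofReal r * volume K ≤ η := by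
    obtain ⟨q, hq, hq'⟩ := ENNReal.exists_nnreal_pos_mul_lt hKv hη
    exact ⟨q, hq, by simpa using hq'.le⟩
  obtain ⟨δ, hδ, H⟩ := Metric.uniformContinuous_iff.1 (hs.uniformContinuous_of_continuous hc) r hr
  filter_upwards [self_mem_nhdsWithin, mem_nhdsWithin_of_mem_nhds (Iio_mem_nhds hδ),
    mem_nhdsWithin_of_mem_nhds (Iio_mem_nhds (zero_lt_one (α := ℝ)))] with ε hε hεδ hε1
  simp only [mem_Ioi, mem_Iio] at hε hεδ hε1
  refine le_trans ?_ hrK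
  rw [← lintegral_indicator_const hKc.measurableSet]
  refine lintegral_mono fun x => ?_
  have hYm : MeasurableSet (univ.pi fun _ : Fin d => Ioo (0 : ℝ) 1) :=
    MeasurableSet.univ_pi fun i => measurableSet_Ioo
  calc ∫⁻ y in univ.pi fun _ : Fin d => Ioo (0 : ℝ) 1, ‖h (SS ε x y) - h x‖ₑ
      ≤ ∫⁻ y in univ.pi fun _ : Fin d => Ioo (0 : ℝ) 1,
          K.indicator (fun _ => ENNReal.ofReal r) x := by
        refine setLIntegral_mono' hYm fun y hy => ?_
        have hd := SS_dist hε x y hy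
        by_cases hx : x ∈ K
        · rw [indicator_of_mem hx, ← ofReal_norm, ← dist_eq_norm]
          exact ENNReal.ofReal_le_ofReal (H (hd.trans_lt hεδ)).le
        · have h1 : h x = 0 := image_eq_zero_of_notMem_tsupport fun hh =>
            hx (Metric.self_subset_cthickening _ hh)
          have h2 : h (SS ε x y) = 0 := image_eq_zero_of_notMem_tsupport fun hh =>
            hx (Metric.mem_cthickening_of_dist_le x _ _ _ hh
              (by rw [dist_comm]; exact hd.trans hε1.le))
          simp [h1, h2]
    _ = K.indicator (fun _ => ENNReal.ofReal r) x := by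
        rw [setLIntegral_const]
        simp [volume_pi_pi]

set_option maxHeartbeats 1000000 in
lemma conv_gen {d : ℕ} {E : Type*} [NormedAddCommGroup E] [NormedSpace ℝ E]
    [MeasurableSpace E] [BorelSpace E] [SecondCountableTopology E] (f : (Fin d → ℝ) → E)
    (hf : Measurable f) (hi : Integrable f) :
    Tendsto (fun ε : ℝ => ∫⁻ x, ∫⁻ y in univ.pi fun _ : Fin d => Ioo (0 : ℝ) 1,
      ‖f (SS ε x y) - f x‖ₑ) (𝓝[>] 0) (𝓝 0) := by
  rw [ENNReal.tendsto_nhds_zero]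
  intro η hη
  have h3 : η / 3 ≠ 0 := by simp [hη.ne']
  obtain ⟨h, hs, hle, hc, -⟩ := hi.exists_hasCompactSupport_lintegral_sub_le h3
  filter_upwards [conv_cpt h hc hs h3, self_mem_nhdsWithin] with ε hε hpos
  simp only [mem_Ioi] at hpos
  have hhm : Measurable h := hc.measurable
  set G : (Fin d → ℝ) → ENNReal := fun x => ‖f x - h x‖ₑ with hG
  have hGm : Measurable G := (hf.sub hhm).enorm
  have hS := SS_meas (d := d) ε
  have hS' : ∀ x, Measurable fun y => SS ε x y := fun x => hS.comp measurable_prodMk_left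
  have hA := unfold_le hpos G hGm
  calc ∫⁻ x, ∫⁻ y in univ.pi fun _ : Fin d => Ioo (0 : ℝ) 1, ‖f (SS ε x y) - f x‖ₑ
      ≤ ∫⁻ x, ∫⁻ y in univ.pi fun _ : Fin d => Ioo (0 : ℝ) 1,
          (G (SS ε x y) + G x + ‖h (SS ε x y) - h x‖ₑ) := by
        refine lintegral_mono fun x => lintegral_mono fun y => ?_
        have : f (SS ε x y) - f x = (f (SS ε x y) - h (SS ε x y)) - (f x - h x)
          + (h (SS ε x y) - h x) := by abel
        rw [this]
        refine (enorm_add_le _ _).trans ?_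
        gcongr
        exact enorm_sub_le
    _ = (∫⁻ x, ∫⁻ y in univ.pi fun _ : Fin d => Ioo (0 : ℝ) 1, G (SS ε x y)) + (∫⁻ x, G x)
        + ∫⁻ x, ∫⁻ y in univ.pi fun _ : Fin d => Ioo (0 : ℝ) 1, ‖h (SS ε x y) - h x‖ₑ := by
        have : ∀ x, ∫⁻ y in univ.pi fun _ : Fin d => Ioo (0 : ℝ) 1,
            (G (SS ε x y) + G x + ‖h (SS ε x y) - h x‖ₑ) =
            (∫⁻ y in univ.pi fun _ : Fin d => Ioo (0 : ℝ) 1, G (SS ε x y)) + G x +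
            ∫⁻ y in univ.pi fun _ : Fin d => Ioo (0 : ℝ) 1, ‖h (SS ε x y) - h x‖ₑ := by
          intro x
          have n1 : Measurable fun y => G (SS ε x y) := hGm.comp (hS' x)
          have n2 : Measurable fun y => G (SS ε x y) + G x := n1.add measurable_const
          rw [lintegral_add_left n2, lintegral_add_left n1, setLIntegral_const]
          simp [volume_pi_pi]
        simp_rw [this]
        have m1 : Measurable fun x => ∫⁻ y in univ.pi fun _ : Fin d => Ioo (0 : ℝ) 1,
            G (SS ε x y) := Measurable.lintegral_prod_right' (hGm.comp hS)
        have m2 : Measurable fun x => (∫⁻ y in univ.pi fun _ : Fin d => Ioo (0 : ℝ) 1,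
            G (SS ε x y)) + G x := m1.add hGm
        rw [lintegral_add_left m2, lintegral_add_left m1]
    _ ≤ η / 3 + η / 3 + η / 3 := by
        gcongr
        exact hA.trans hle
    _ = η := ENNReal.add_thirds η

theorem twoScale_strong_convergence_of_caratheodory
    (d : ℕ) (hd : 1 ≤ d)
    (v : (Fin d → ℝ) → (Fin d → ℝ) → ℝ)
    (hmeas : ∀ y, Measurable fun x => v x y)
    (hcont : ∀ᵐ x ∂(volume : Measure (Fin d → ℝ)), Continuous fun y => v x y)
    (hper : ∀ (x y : Fin d → ℝ) (k : Fin d → ℤ),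
      v x (y + fun i => (k i : ℝ)) = v x y)
    (hint : Integrable fun x => ⨆ y : Icc (0 : Fin d → ℝ) 1, |v x (y : Fin d → ℝ)|) :
    Tendsto
      (fun ε : ℝ => ∫ x : Fin d → ℝ,
        ∫ y in univ.pi fun _ : Fin d => Ioo (0 : ℝ) 1,
          |v (fun i => ε * ((⌊x i / ε⌋ : ℝ) + y i)) y - v x y|)
      (𝓝[>] 0) (𝓝 0) := by
  classical
  set N := toMeasurable volume {x : Fin d → ℝ | ¬ Continuous fun y => v x y} with hNdef
  have hN : MeasurableSet N := measurableSet_toMeasurable _ _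
  have hN0 : volume N = 0 := by rw [hNdef, measure_toMeasurable]; exact hcont
  have hNc : ∀ x, x ∉ N → Continuous fun y => v x y := by
    intro x hx
    by_contra hh
    exact hx (subset_toMeasurable _ _ hh)
  have hNae : ∀ᵐ x : Fin d → ℝ, x ∉ N := measure_eq_zero_iff_ae_notMem.1 hN0
  haveI : Nonempty (Icc (0 : Fin d → ℝ) 1) := ⟨⟨0, by simp⟩⟩
  haveI : CompactSpace (Icc (0 : Fin d → ℝ) 1) := isCompact_iff_compactSpace.1 isCompact_Icc
  letI : MeasurableSpace C(Icc (0 : Fin d → ℝ) 1, ℝ) := borel _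
  haveI : BorelSpace C(Icc (0 : Fin d → ℝ) 1, ℝ) := ⟨rfl⟩
  let f : (Fin d → ℝ) → C(Icc (0 : Fin d → ℝ) 1, ℝ) := fun x =>
    if h : x ∈ N then 0 else ⟨fun y => v x y, (hNc x h).comp continuous_subtype_val⟩
  have hfe : ∀ x, x ∉ N → ∀ y, f x y = v x y := by
    intro x hx y
    simp [f, hx]
  have hf : Measurable f := by
    apply meas_of_eval
    intro y
    have : (fun x => f x y) = Nᶜ.indicator fun x => v x y := by
      ext x
      by_cases hx : x ∈ N <;> simp [f, hx]
    rw [this]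
    exact (hmeas y).indicator hN.compl
  have hi : Integrable f := by
    rw [← integrable_norm_iff hf.aestronglyMeasurable]
    refine hint.congr ?_
    filter_upwards [hNae] with x hx
    rw [ContinuousMap.norm_eq_iSup_norm]
    simp only [hfe x hx, Real.norm_eq_abs]
  have H := conv_gen f hf hi
  rw [tendsto_zero_iff_enorm_tendsto_zero]
  refine tendsto_of_tendsto_of_tendsto_of_le_of_le' tendsto_const_nhds H
    (Eventually.of_forall fun _ => zero_le) ?_
  filter_upwards [self_mem_nhdsWithin] with ε hε
  simp only [mem_Ioi] at hε
  refine (enorm_integral_le_lintegral_enorm _).trans (lintegral_mono_ae ?_)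
  filter_upwards [hNae] with x hx
  refine (enorm_integral_le_lintegral_enorm _).trans (lintegral_mono_ae ?_)
  filter_upwards [ae_restrict_of_ae (affine_null hε (fun i => (⌊x i / ε⌋ : ℝ)) hN hN0),
    ae_restrict_mem (MeasurableSet.univ_pi fun i => measurableSet_Ioo)] with y hy hyY
  have hyI : y ∈ Icc (0 : Fin d → ℝ) 1 :=
    ⟨fun i => (hyY i (mem_univ i)).1.le, fun i => (hyY i (mem_univ i)).2.le⟩
  have e1 := hfe _ hy ⟨y, hyI⟩
  have e2 := hfe _ hx ⟨y, hyI⟩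
  simp only at e1 e2
  rw [← e1, ← e2, ← Real.norm_eq_abs, enorm_norm]
  have := ContinuousMap.norm_coe_le_norm (f (SS ε x y) - f x) ⟨y, hyI⟩
  rw [← ofReal_norm, ← ofReal_norm]
  exact ENNReal.ofReal_le_ofReal this
end

section
/- Let d ≥ 1, Ω ⊂ ℝ^d a bounded open set, and (ε_k) a sequence of positive numbers with ε_k → 0. For each k let v_k ∈ L¹(ℝ^d) vanish outside Ω, and assume that the unfolded sequence (x,y) ↦ v_k(S_{ε_k}(x,y)) converges weakly in L¹(ℝ^d × Y) to v⁰. Then v_k converges weakly in L¹(ℝ^d) to the averaged function x ↦ ∫_Y v⁰(x,y) dy. -/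
open MeasureTheory Set Filter Topology

/-- The unit cell `Y = (0,1)^d`. -/
def unitCell (d : ℕ) : Set (Fin d → ℝ) := univ.pi fun _ => Ioo (0 : ℝ) 1

/-- The two-scale composition map `S_ε(x,y) = ε(⌊x/ε⌋ + y)`. -/
noncomputable def twoScale {d : ℕ} (ε : ℝ) (x y : Fin d → ℝ) : Fin d → ℝ :=
  fun i => ε * ((⌊x i / ε⌋ : ℝ) + y i)


lemma aux_mp1 (ε : ℝ) (hε : 0 < ε) :
    MeasurePreserving (fun p : ℝ × ℝ => ε * ((⌊p.1 / ε⌋ : ℝ) + p.2))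
      (volume.prod (volume.restrict (Ioo (0:ℝ) 1))) volume := by
  have hm : Measurable (fun p : ℝ × ℝ => ε * ((⌊p.1 / ε⌋ : ℝ) + p.2)) := by fun_prop
  refine ⟨hm, ?_⟩
  ext A hA
  rw [Measure.map_apply hm hA, Measure.prod_apply (hm hA)]
  have hfl : Measurable (fun x : ℝ => ⌊x / ε⌋) := by fun_prop
  set Cc : ℤ → Set ℝ := fun n => (fun x : ℝ => ⌊x / ε⌋) ⁻¹' {n} with hC
  have hCm : ∀ n, MeasurableSet (Cc n) := fun n => hfl (measurableSet_singleton n)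
  have hCd : Pairwise (Function.onFun Disjoint Cc) := by
    intro m n hmn
    refine Disjoint.preimage _ ?_
    simpa using hmn
  have hCu : ⋃ n, Cc n = univ := by
    ext x; simp [hC]
  have hCI : ∀ n, Cc n = Ico (ε * n) (ε * (n + 1)) := by
    intro n
    ext x
    simp only [hC, mem_preimage, mem_singleton_iff, Int.floor_eq_iff, mem_Ico]
    rw [le_div_iff₀ hε, div_lt_iff₀ hε, mul_comm ε, mul_comm ε]
  have hvol : volume A = ∑' n, volume (A ∩ Cc n) := by
    rw [← measure_iUnion (fun m n h => (hCd h).mono inter_subset_right inter_subset_right)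
      (fun n => hA.inter (hCm n)), ← inter_iUnion, hCu, inter_univ]
  rw [← setLIntegral_univ, ← hCu, lintegral_iUnion hCm hCd, hvol]
  congr 1
  ext n
  have h1 : ∀ x ∈ Cc n, (volume.restrict (Ioo (0:ℝ) 1)) (Prod.mk x ⁻¹' ((fun p : ℝ × ℝ => ε * ((⌊p.1 / ε⌋ : ℝ) + p.2)) ⁻¹' A)) = (volume.restrict (Ioo (0:ℝ) 1)) ((fun y : ℝ => ε * (n + y)) ⁻¹' A) := by
    intro x hx
    have : ⌊x / ε⌋ = n := hx
    congr 1
    ext y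
    simp [this]
  rw [setLIntegral_congr_fun (hCm n) h1, setLIntegral_const, 
    Measure.restrict_congr_set Ioo_ae_eq_Ico, Measure.restrict_apply ((by fun_prop : Measurable (fun y : ℝ => ε * (n + y))) hA)]
  have h2 : (fun y : ℝ => ε * (n + y)) ⁻¹' A ∩ Ico 0 1 =
     (fun y => ε * y) ⁻¹' ((fun y => ε * n + y) ⁻¹' (A ∩ Cc n)) := by
    ext y
    rw [hCI]
    simp only [mem_inter_iff, mem_preimage, mem_Ico, mul_add]
    refine and_congr_right fun _ => and_congr ?_ ?_
    · simp [hε]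
    · simp [hε]
  rw [h2, Real.volume_preimage_mul_left hε.ne', measure_preimage_add, hCI n, Real.volume_Ico]
  have : ε * (n + 1) - ε * n = ε := by ring
  rw [this, abs_of_pos (inv_pos.2 hε), mul_comm, ← mul_assoc, ← ENNReal.ofReal_mul hε.le,
    mul_inv_cancel₀ hε.ne']
  simp

lemma aux_mp (d : ℕ) (ε : ℝ) (hε : 0 < ε) :
    MeasurePreserving (fun p : (Fin d → ℝ) × (Fin d → ℝ) => twoScale ε p.1 p.2)
      (volume.prod (volume.restrict (unitCell d))) volume := by
  have h1 := measurePreserving_pi (fun _ : Fin d => (volume : Measure ℝ).prod (volume.restrict (Ioo (0:ℝ) 1)))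
    (fun _ => (volume : Measure ℝ)) (fun _ => aux_mp1 ε hε)
  have h2 := (measurePreserving_arrowProdEquivProdArrow ℝ ℝ (Fin d) (fun _ => (volume : Measure ℝ))
    (fun _ => volume.restrict (Ioo (0:ℝ) 1))).symm
  have h3 := h1.comp h2
  rw [← volume_pi, ← Measure.restrict_pi_pi, ← volume_pi] at h3
  exact h3

lemma aux_prob (d : ℕ) : IsProbabilityMeasure ((volume : Measure (Fin d → ℝ)).restrict (unitCell d)) := by
  constructor
  simp [unitCell, volume_pi_pi]

lemma aux_cont {α : Type*} [MeasurableSpace α] {μ : Measure α} {w : α → ℝ} (hw : Integrable w μ)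
    (F : ℕ → Lp ℝ 1 μ) (f : Lp ℝ 1 μ) (hF : ∀ n, ∀ᵐ p ∂μ, |F n p| ≤ 1)
    (h : Tendsto F atTop (𝓝 f)) :
    Tendsto (fun n => ∫ p, w p * F n p ∂μ) atTop (𝓝 (∫ p, w p * f p ∂μ)) := by
  refine tendsto_of_subseq_tendsto fun ns hns => ?_
  obtain ⟨ms, _, hms⟩ := (tendstoInMeasure_of_tendsto_Lp (h.comp hns)).exists_seq_tendsto_ae
  refine ⟨ms, ?_⟩
  refine tendsto_integral_of_dominated_convergence (fun p => ‖w p‖) ?_ hw.norm ?_ ?_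
  · intro n
    exact hw.1.mul (Lp.aestronglyMeasurable _)
  · intro n
    filter_upwards [hF (ns (ms n))] with p hp
    rw [norm_mul]
    exact mul_le_of_le_one_right (norm_nonneg _) hp
  · filter_upwards [hms] with p hp
    exact hp.const_mul _

lemma aux_closed {α : Type*} [MeasurableSpace α] {μ : Measure α} :
    IsClosed {f : Lp ℝ 1 μ | ∀ᵐ p ∂μ, |f p| ≤ 1} := by
  refine IsSeqClosed.isClosed fun F f hF h => ?_
  obtain ⟨ms, _, hms⟩ := (tendstoInMeasure_of_tendsto_Lp h).exists_seq_tendsto_ae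
  have : ∀ᵐ p ∂μ, ∀ n, |F n p| ≤ 1 := ae_all_iff.2 hF
  filter_upwards [hms, this] with p hp hq
  exact le_of_tendsto hp.abs (Eventually.of_forall fun n => hq _)

lemma aux_key {α : Type*} [MeasurableSpace α] {μ : Measure α} (w : ℕ → α → ℝ)
    (hw : ∀ k, Integrable (w k) μ)
    (hconv : ∀ φ : α → ℝ, Measurable φ → (∃ C, ∀ᵐ p ∂μ, |φ p| ≤ C) →
      ∃ L, Tendsto (fun k => ∫ p, w k p * φ p ∂μ) atTop (𝓝 L))
    (g : ℕ → α → ℝ) (hgi : ∀ k, Integrable (g k) μ) (hgb : ∀ k, ∀ᵐ p ∂μ, |g k p| ≤ 1)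
    (hg0 : Tendsto (fun k => ∫ p, ‖g k p‖ ∂μ) atTop (𝓝 0)) :
    Tendsto (fun k => ∫ p, w k p * g k p ∂μ) atTop (𝓝 0) := by
  set X : Set (Lp ℝ 1 μ) := {f | ∀ᵐ p ∂μ, |f p| ≤ 1} with hX
  have hXc : IsClosed X := aux_closed
  have : CompleteSpace X := hXc.completeSpace_coe
  have hX0 : (0 : Lp ℝ 1 μ) ∈ X := by
    filter_upwards [Lp.coeFn_zero ℝ 1 μ] with p hp
    rw [hp]; simp
  have : Nonempty X := ⟨⟨0, hX0⟩⟩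
  have hcontX : ∀ k, Continuous fun f : X => ∫ p, w k p * (f : Lp ℝ 1 μ) p ∂μ := by
    intro k
    refine continuous_iff_seqContinuous.2 fun F f h => ?_
    exact aux_cont (hw k) (fun n => (F n : Lp ℝ 1 μ)) f (fun n => (F n).2)
      ((continuous_subtype_val.tendsto f).comp h)
  have hint : ∀ k (f : Lp ℝ 1 μ), f ∈ X → Integrable (fun p => w k p * f p) μ := by
    intro k f hf
    refine (hw k).mul_bdd (c := 1) (Lp.aestronglyMeasurable f) ?_
    exact hf
  -- transfer `g` to `L¹`
  set G : ℕ → Lp ℝ 1 μ := fun k => (hgi k).toL1 (g k) with hG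
  have hGg : ∀ k, G k =ᵐ[μ] g k := fun k => (hgi k).coeFn_toL1
  have hGX : ∀ k, G k ∈ X := by
    intro k
    filter_upwards [hGg k, hgb k] with p hp hq
    rw [hp]; exact hq
  have hGn : ∀ k, ‖G k‖ = ∫ p, ‖g k p‖ ∂μ := fun k => L1.norm_of_fun_eq_integral_norm (hgi k)
  have hG0 : Tendsto G atTop (𝓝 0) := by
    rw [tendsto_zero_iff_norm_tendsto_zero]
    simpa only [hGn] using hg0
  have hGi : ∀ j k, ∫ p, w j p * g k p ∂μ = ∫ p, w j p * G k p ∂μ := by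
    intro j k
    refine integral_congr_ae ?_
    filter_upwards [hGg k] with p hp
    rw [hp]
  simp only [hGi]
  rw [Metric.tendsto_atTop]
  intro η hη
  -- Baire
  set E : ℕ → Set X := fun N => {f | ∀ k ≥ N,
    |∫ p, w k p * (f : Lp ℝ 1 μ) p ∂μ - ∫ p, w N p * (f : Lp ℝ 1 μ) p ∂μ| ≤ η / 4} with hE
  have hEc : ∀ N, IsClosed (E N) := by
    intro N
    simp only [hE, ofPred_forall]
    refine isClosed_iInter fun k => isClosed_iInter fun _ => ?_
    exact isClosed_le ((hcontX k).sub (hcontX N)).abs continuous_const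
  have hEu : ⋃ N, E N = univ := by
    refine eq_univ_of_forall fun f => ?_
    obtain ⟨L, hL⟩ := hconv (f : Lp ℝ 1 μ) (Lp.stronglyMeasurable _).measurable ⟨1, f.2⟩
    obtain ⟨N, hN⟩ := Metric.cauchySeq_iff'.1 hL.cauchySeq (η / 4) (by positivity)
    exact mem_iUnion.2 ⟨N, fun k hk => (hN k hk).le⟩
  obtain ⟨N, f0, hf0⟩ := nonempty_interior_of_iUnion_of_closed hEc hEu
  obtain ⟨r, hr, hball⟩ := Metric.mem_nhds_iff.1 (mem_interior_iff_mem_nhds.1 hf0)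
  -- the splitting
  have hsplit : ∀ h : Lp ℝ 1 μ, h ∈ X → ‖h‖ < r → ∀ k ≥ N,
      |∫ p, w k p * h p ∂μ - ∫ p, w N p * h p ∂μ| ≤ η / 2 := by
    intro h hh hhr k hk
    set P : Set α := {p | (f0 : Lp ℝ 1 μ) p * h p ≤ 0} with hP
    have hPm : MeasurableSet P := measurableSet_le
      ((Lp.stronglyMeasurable _).measurable.mul (Lp.stronglyMeasurable _).measurable)
      measurable_const
    have hhi : Integrable h μ := L1.integrable_coeFn h
    have hi1 : Integrable (P.indicator h) μ := hhi.indicator hPm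
    have hi2 : Integrable (Pᶜ.indicator h) μ := hhi.indicator hPm.compl
    set h1 : Lp ℝ 1 μ := hi1.toL1 _
    set h2 : Lp ℝ 1 μ := hi2.toL1 _
    have e1 : h1 =ᵐ[μ] P.indicator h := hi1.coeFn_toL1
    have e2 : h2 =ᵐ[μ] Pᶜ.indicator h := hi2.coeFn_toL1
    have n1 : ‖h1‖ ≤ ‖h‖ := by
      refine Lp.norm_le_norm_of_ae_le ?_
      filter_upwards [e1] with p hp
      rw [hp]; exact norm_indicator_le_norm_self _ _
    have n2 : ‖h2‖ ≤ ‖h‖ := by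
      refine Lp.norm_le_norm_of_ae_le ?_
      filter_upwards [e2] with p hp
      rw [hp]; exact norm_indicator_le_norm_self _ _
    set a : Lp ℝ 1 μ := f0 + h1
    set b : Lp ℝ 1 μ := f0 - h2
    have ea : a =ᵐ[μ] fun p => (f0 : Lp ℝ 1 μ) p + P.indicator h p := by
      filter_upwards [Lp.coeFn_add (f0 : Lp ℝ 1 μ) h1, e1] with p hp hq
      rw [hp, Pi.add_apply, hq]
    have eb : b =ᵐ[μ] fun p => (f0 : Lp ℝ 1 μ) p - Pᶜ.indicator h p := by
      filter_upwards [Lp.coeFn_sub (f0 : Lp ℝ 1 μ) h2, e2] with p hp hq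
      rw [hp, Pi.sub_apply, hq]
    have haX : a ∈ X := by
      show ∀ᵐ p ∂μ, |a p| ≤ 1
      have hf02 : ∀ᵐ p ∂μ, |(f0 : Lp ℝ 1 μ) p| ≤ 1 := f0.2
      filter_upwards [ea, hf02, hh] with p hp h3 h4
      rw [hp]
      by_cases hpP : p ∈ P
      · rw [indicator_of_mem hpP]
        have : (f0 : Lp ℝ 1 μ) p * h p ≤ 0 := hpP
        rw [abs_le] at *
        rcases mul_nonpos_iff.1 this with h5 | h5 <;> constructor <;> linarith
      · rw [indicator_of_notMem hpP, add_zero]; exact h3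
    have hbX : b ∈ X := by
      show ∀ᵐ p ∂μ, |b p| ≤ 1
      have hf02 : ∀ᵐ p ∂μ, |(f0 : Lp ℝ 1 μ) p| ≤ 1 := f0.2
      filter_upwards [eb, hf02, hh] with p hp h3 h4
      rw [hp]
      by_cases hpP : p ∈ P
      · rw [indicator_of_notMem (by simpa using hpP), sub_zero]; exact h3
      · rw [indicator_of_mem (by simpa using hpP)]
        have : 0 < (f0 : Lp ℝ 1 μ) p * h p := not_le.1 hpP
        rw [abs_le] at *
        rcases mul_pos_iff.1 this with h5 | h5 <;> constructor <;> linarith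
    have haE : (⟨a, haX⟩ : X) ∈ E N := hball (by
      rw [Metric.mem_ball, Subtype.dist_eq, dist_eq_norm]
      simpa [a] using n1.trans_lt hhr)
    have hbE : (⟨b, hbX⟩ : X) ∈ E N := hball (by
      rw [Metric.mem_ball, Subtype.dist_eq, dist_eq_norm]
      simpa [b] using n2.trans_lt hhr)
    have hdiff : ∀ j, ∫ p, w j p * h p ∂μ = ∫ p, w j p * a p ∂μ - ∫ p, w j p * b p ∂μ := by
      intro j
      rw [← integral_sub (hint j a haX) (hint j b hbX)]
      refine integral_congr_ae ?_
      filter_upwards [ea, eb] with p hp hq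
      rw [hp, hq, ← mul_sub]
      congr 1
      by_cases hpP : p ∈ P
      · simp [hpP]
      · simp [hpP]
    have h5 := haE k hk
    have h6 := hbE k hk
    simp only at h5 h6
    rw [hdiff, hdiff]
    rw [abs_le] at *
    constructor <;> linarith
  have hN0 : Tendsto (fun n => ∫ p, w N p * G n p ∂μ) atTop (𝓝 0) := by
    have := aux_cont (hw N) G 0 hGX hG0
    have h0 : ∫ p, w N p * (0 : Lp ℝ 1 μ) p ∂μ = 0 := by
      rw [← integral_zero α ℝ (μ := μ)]
      refine integral_congr_ae ?_
      filter_upwards [Lp.coeFn_zero ℝ 1 μ] with p hp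
      rw [hp]; simp
    rwa [h0] at this
  obtain ⟨N1, hN1⟩ := Metric.tendsto_atTop.1 hN0 (η / 2) (by positivity)
  obtain ⟨N2, hN2⟩ := Metric.tendsto_atTop.1 hG0 r hr
  refine ⟨max N (max N1 N2), fun n hn => ?_⟩
  have k0 : n ≥ N := (le_max_left _ _).trans hn
  have k1 : n ≥ N1 := ((le_max_left _ _).trans (le_max_right _ _)).trans hn
  have k2 : n ≥ N2 := ((le_max_right _ _).trans (le_max_right _ _)).trans hn
  have q1 := hN1 n k1
  have q2 := hsplit (G n) (hGX n) (by simpa using hN2 n k2) n k0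
  rw [Real.dist_eq, sub_zero] at *
  rw [abs_lt] at *
  rw [abs_le] at *
  constructor <;> linarith

lemma aux_dist {d : ℕ} (ε : ℝ) (hε : 0 < ε) (x y : Fin d → ℝ) (hy : y ∈ unitCell d) :
    dist (twoScale ε x y) x ≤ ε := by
  rw [dist_pi_le_iff hε.le]
  intro i
  have hyi : y i ∈ Ioo (0:ℝ) 1 := hy i (mem_univ i)
  have h1 : twoScale ε x y i - x i = ε * (y i - Int.fract (x i / ε)) := by
    simp only [twoScale, Int.fract]
    field_simp
    ring
  rw [Real.dist_eq, h1, abs_mul, abs_of_pos hε]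
  refine mul_le_of_le_one_right hε.le ?_
  have h2 := Int.fract_nonneg (x i / ε)
  have h3 := Int.fract_lt_one (x i / ε)
  rw [abs_le]
  constructor <;> linarith [hyi.1, hyi.2]

lemma aux_ae (d : ℕ) : ∀ᵐ p ∂((volume : Measure (Fin d → ℝ)).prod
    (volume.restrict (unitCell d))), p.2 ∈ unitCell d := by
  have := aux_prob d
  have hm : MeasurableSet (unitCell d) := MeasurableSet.univ_pi fun _ => measurableSet_Ioo
  exact Measure.quasiMeasurePreserving_snd.ae (ae_restrict_mem hm)

lemma aux_cc (d : ℕ) (ε : ℕ → ℝ) (hεpos : ∀ k, 0 < ε k) (hε0 : Tendsto ε atTop (𝓝 0))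
    (g : (Fin d → ℝ) → ℝ) (hg : Continuous g) (hgc : HasCompactSupport g) :
    Tendsto (fun k => ∫ p : (Fin d → ℝ) × (Fin d → ℝ), ‖g (twoScale (ε k) p.1 p.2) - g p.1‖
      ∂(volume.prod (volume.restrict (unitCell d)))) atTop (𝓝 0) := by
  have := aux_prob d
  obtain ⟨M, hM⟩ := hgc.exists_bound_of_continuous hg
  have hM0 : 0 ≤ M := (norm_nonneg _).trans (hM 0)
  set B := Metric.cthickening 1 (tsupport g) with hB
  have hBm : MeasurableSet B := Metric.isClosed_cthickening.measurableSet
  have hBv : volume B < ⊤ := (hgc.isBounded.cthickening).measure_lt_top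
  have hmp := fun k => aux_mp d (ε k) (hεpos k)
  have hz : (0:ℝ) = ∫ p : (Fin d → ℝ) × (Fin d → ℝ), (0:ℝ)
      ∂(volume.prod (volume.restrict (unitCell d))) := by simp
  rw [hz]
  refine tendsto_integral_filter_of_dominated_convergence
    (fun p => B.indicator (fun _ => 2 * M) p.1) ?_ ?_ ?_ ?_
  · refine Eventually.of_forall fun k => ?_
    have h1 : Measurable fun p : (Fin d → ℝ) × (Fin d → ℝ) => g (twoScale (ε k) p.1 p.2) :=
      hg.measurable.comp (hmp k).measurable
    have h2 : Measurable fun p : (Fin d → ℝ) × (Fin d → ℝ) => g p.1 :=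
      hg.measurable.comp measurable_fst
    exact (h1.sub h2).norm.aestronglyMeasurable
  · filter_upwards [hε0.eventually (gt_mem_nhds one_pos)] with k hk
    filter_upwards [aux_ae d] with p hp
    have hd := (aux_dist (ε k) (hεpos k) p.1 p.2 hp).trans hk.le
    rw [norm_norm]
    by_cases hpB : p.1 ∈ B
    · rw [indicator_of_mem hpB]
      exact (norm_sub_le _ _).trans (by linarith [hM (twoScale (ε k) p.1 p.2), hM p.1])
    · rw [indicator_of_notMem hpB]
      have h1 : g p.1 = 0 := image_eq_zero_of_notMem_tsupport fun h =>
        hpB (Metric.self_subset_cthickening _ h)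
      have h2 : g (twoScale (ε k) p.1 p.2) = 0 := image_eq_zero_of_notMem_tsupport fun h =>
        hpB (Metric.mem_cthickening_of_dist_le _ _ _ _ h (by rwa [dist_comm]))
      simp [h1, h2]
  · have : Integrable (B.indicator (fun _ => 2 * M)) (volume : Measure (Fin d → ℝ)) :=
      (integrable_indicator_iff hBm).2 (integrableOn_const hBv.ne)
    exact measurePreserving_fst.integrable_comp_of_integrable this
  · filter_upwards [aux_ae d] with p hp
    have h1 : Tendsto (fun k => twoScale (ε k) p.1 p.2) atTop (𝓝 p.1) := by
      rw [tendsto_iff_dist_tendsto_zero]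
      exact squeeze_zero (fun _ => dist_nonneg) (fun k => aux_dist (ε k) (hεpos k) p.1 p.2 hp) hε0
    have h2 := (((hg.tendsto p.1).comp h1).sub_const (g p.1)).norm
    simpa using h2

lemma aux_L1 (d : ℕ) (ε : ℕ → ℝ) (hεpos : ∀ k, 0 < ε k) (hε0 : Tendsto ε atTop (𝓝 0))
    (f : (Fin d → ℝ) → ℝ) (hf : Integrable f) :
    Tendsto (fun k => ∫ p : (Fin d → ℝ) × (Fin d → ℝ), ‖f (twoScale (ε k) p.1 p.2) - f p.1‖
      ∂(volume.prod (volume.restrict (unitCell d)))) atTop (𝓝 0) := by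
  have := aux_prob d
  have hmp := fun k => aux_mp d (ε k) (hεpos k)
  have hfst : MeasurePreserving Prod.fst ((volume : Measure (Fin d → ℝ)).prod
    (volume.restrict (unitCell d))) volume := measurePreserving_fst
  rw [Metric.tendsto_atTop]
  intro η hη
  obtain ⟨g, hgc, hfg, hg, hgi⟩ := hf.exists_hasCompactSupport_integral_sub_le
    (show (0:ℝ) < η / 4 by positivity)
  obtain ⟨N, hN⟩ := Metric.tendsto_atTop.1 (aux_cc d ε hεpos hε0 g hg hgc) (η / 2) (by positivity)
  refine ⟨N, fun k hk => ?_⟩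
  have hNk := hN k hk
  rw [Real.dist_eq, sub_zero, abs_of_nonneg (integral_nonneg fun _ => norm_nonneg _)] at hNk ⊢
  have hD : Integrable (fun x => ‖f x - g x‖) := (hf.sub hgi).norm
  have i1 := (hmp k).integrable_comp_of_integrable hD
  have i2 := hfst.integrable_comp_of_integrable hD
  have i3 := (((hmp k).integrable_comp_of_integrable hgi).sub
    (hfst.integrable_comp_of_integrable hgi)).norm
  have i4 := (((hmp k).integrable_comp_of_integrable hf).sub
    (hfst.integrable_comp_of_integrable hf)).norm
  have e1 := integral_map (hmp k).measurable.aemeasurable (f := fun x => ‖f x - g x‖)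
    (by rw [(hmp k).map_eq]; exact hD.1)
  have e2 := integral_map hfst.measurable.aemeasurable (f := fun x => ‖f x - g x‖)
    (by rw [hfst.map_eq]; exact hD.1)
  rw [(hmp k).map_eq] at e1
  rw [hfst.map_eq] at e2
  have hle := integral_mono i4 ((i1.add i3).add i2) (fun p => by
    simp only [Function.comp, Pi.add_apply, Pi.sub_apply]
    have h1 := norm_add₃_le (a := f (twoScale (ε k) p.1 p.2) - g (twoScale (ε k) p.1 p.2))
      (b := g (twoScale (ε k) p.1 p.2) - g p.1) (c := g p.1 - f p.1)
    rw [norm_sub_rev (g p.1) (f p.1)] at h1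
    refine le_trans (le_of_eq ?_) h1
    congr 1; ring)
  rw [integral_add' (i1.add i3) i2, integral_add' i1 i3] at hle
  simp only [Function.comp_def, Pi.sub_apply] at hle
  linarith

theorem twoScale_weak_limit_average
    (d : ℕ) (hd : 1 ≤ d) (Ω : Set (Fin d → ℝ)) (hΩo : IsOpen Ω)
    (hΩb : Bornology.IsBounded Ω)
    (ε : ℕ → ℝ) (hεpos : ∀ k, 0 < ε k) (hε0 : Tendsto ε atTop (𝓝 0))
    (v : ℕ → (Fin d → ℝ) → ℝ)
    (hvInt : ∀ k, Integrable (v k))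
    (hv0out : ∀ k, ∀ x ∉ Ω, v k x = 0)
    (v0 : (Fin d → ℝ) → (Fin d → ℝ) → ℝ)
    (hunfInt : ∀ k, Integrable (fun p : (Fin d → ℝ) × (Fin d → ℝ) =>
      v k (twoScale (ε k) p.1 p.2)) (volume.prod (volume.restrict (unitCell d))))
    (hv0Int : Integrable (fun p : (Fin d → ℝ) × (Fin d → ℝ) => v0 p.1 p.2)
      (volume.prod (volume.restrict (unitCell d))))
    (hweak : ∀ φ : (Fin d → ℝ) × (Fin d → ℝ) → ℝ, Measurable φ →
      (∃ C, ∀ᵐ p ∂(volume.prod (volume.restrict (unitCell d))), |φ p| ≤ C) →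
      Tendsto
        (fun k => ∫ p, v k (twoScale (ε k) p.1 p.2) * φ p
          ∂(volume.prod (volume.restrict (unitCell d)))) atTop
        (𝓝 (∫ p, v0 p.1 p.2 * φ p ∂(volume.prod (volume.restrict (unitCell d)))))) :
    Integrable (fun x => ∫ y in unitCell d, v0 x y) ∧
    ∀ φ : (Fin d → ℝ) → ℝ, Measurable φ →
      (∃ C, ∀ᵐ x ∂(volume : Measure (Fin d → ℝ)), |φ x| ≤ C) →
      Tendsto (fun k => ∫ x, v k x * φ x) atTop
        (𝓝 (∫ x, (∫ y in unitCell d, v0 x y) * φ x)) := by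
  have := aux_prob d
  have hmp := fun k => aux_mp d (ε k) (hεpos k)
  have hfst : MeasurePreserving Prod.fst ((volume : Measure (Fin d → ℝ)).prod
    (volume.restrict (unitCell d))) volume := measurePreserving_fst
  refine ⟨hv0Int.integral_prod_left, ?_⟩
  rintro φ hφ ⟨C0, hC0⟩
  obtain ⟨C, hCpos, hC⟩ : ∃ C : ℝ, 0 < C ∧ ∀ᵐ x ∂(volume : Measure (Fin d → ℝ)), |φ x| ≤ C :=
    ⟨max C0 1, by positivity, hC0.mono fun x hx => hx.trans (le_max_left _ _)⟩
  set μ := (volume : Measure (Fin d → ℝ)).prod (volume.restrict (unitCell d)) with hμ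
  set B := Metric.cthickening 1 Ω with hB
  have hBm : MeasurableSet B := Metric.isClosed_cthickening.measurableSet
  have hBv : volume B < ⊤ := hΩb.cthickening.measure_lt_top
  set f : (Fin d → ℝ) → ℝ := B.indicator φ with hf
  have hfC : ∀ᵐ x ∂(volume : Measure (Fin d → ℝ)), |f x| ≤ C := by
    filter_upwards [hC] with x hx
    exact (norm_indicator_le_norm_self φ x).trans hx
  have hfi : Integrable f := by
    refine (integrable_indicator_iff hBm).2 ?_
    exact Measure.integrableOn_of_bounded hBv.ne hφ.aestronglyMeasurable
      (ae_restrict_of_ae hC)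
  -- the error term
  have herr : Tendsto (fun k => ∫ p, v k (twoScale (ε k) p.1 p.2) *
      ((2 * C)⁻¹ * (f (twoScale (ε k) p.1 p.2) - f p.1)) ∂μ) atTop (𝓝 0) := by
    refine aux_key (α := (Fin d → ℝ) × (Fin d → ℝ)) (μ := μ)
      (fun k p => v k (twoScale (ε k) p.1 p.2)) (fun k => hunfInt k)
      (fun ψ h1 h2 => ⟨_, hweak ψ h1 h2⟩)
      (fun k p => (2 * C)⁻¹ * (f (twoScale (ε k) p.1 p.2) - f p.1)) ?_ ?_ ?_
    · intro k
      exact (((hmp k).integrable_comp_of_integrable hfi).sub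
        (hfst.integrable_comp_of_integrable hfi)).const_mul _
    · intro k
      filter_upwards [(hmp k).quasiMeasurePreserving.ae hfC,
        hfst.quasiMeasurePreserving.ae hfC] with p h1 h2
      rw [abs_mul, abs_of_pos (by positivity), inv_mul_le_iff₀ (by positivity)]
      exact (abs_sub _ _).trans (by linarith)
    · have := (aux_L1 d ε hεpos hε0 f hfi).const_mul (2 * C)⁻¹
      rw [mul_zero] at this
      refine this.congr fun k => ?_
      rw [← integral_const_mul]
      congr 1
      ext p
      rw [norm_mul, Real.norm_of_nonneg (show (0:ℝ) ≤ (2 * C)⁻¹ by positivity)]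
  have hmain := hweak (fun p => φ p.1) (hφ.comp measurable_fst)
    ⟨C, hfst.quasiMeasurePreserving.ae hC⟩
  have hlim : ∫ p, v0 p.1 p.2 * φ p.1 ∂μ = ∫ x, (∫ y in unitCell d, v0 x y) * φ x := by
    have hi : Integrable (fun p : (Fin d → ℝ) × (Fin d → ℝ) => v0 p.1 p.2 * φ p.1) μ :=
      hv0Int.mul_bdd (c := C) (hφ.comp measurable_fst).aestronglyMeasurable
        (hfst.quasiMeasurePreserving.ae hC)
    rw [hμ, integral_prod _ hi]
    simp only [integral_mul_const]
  have hsum := hmain.add (herr.const_mul (2 * C))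
  rw [mul_zero, add_zero, hlim] at hsum
  refine hsum.congr' ?_
  filter_upwards [hε0.eventually (gt_mem_nhds one_pos)] with k hk
  have a1 : ∫ x, v k x * φ x = ∫ p, v k (twoScale (ε k) p.1 p.2) * φ (twoScale (ε k) p.1 p.2) ∂μ := by
    have h := integral_map (hmp k).measurable.aemeasurable (f := fun x => v k x * φ x)
      (by rw [(hmp k).map_eq]; exact (hvInt k).1.mul hφ.aestronglyMeasurable)
    rwa [(hmp k).map_eq] at h
  have j1 : Integrable (fun p : (Fin d → ℝ) × (Fin d → ℝ) =>
      v k (twoScale (ε k) p.1 p.2) * φ p.1) μ :=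
    (hunfInt k).mul_bdd (c := C) (hφ.comp measurable_fst).aestronglyMeasurable
        (hfst.quasiMeasurePreserving.ae hC)
  have j2 : Integrable (fun p : (Fin d → ℝ) × (Fin d → ℝ) =>
      2 * C * (v k (twoScale (ε k) p.1 p.2) *
      ((2 * C)⁻¹ * (f (twoScale (ε k) p.1 p.2) - f p.1)))) μ := by
    refine Integrable.const_mul ?_ _
    refine (hunfInt k).mul_bdd (c := (2 * C)⁻¹ * (2 * C)) ?_ ?_
    · exact (((hmp k).integrable_comp_of_integrable hfi).sub
        (hfst.integrable_comp_of_integrable hfi)).1.const_mul _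
    · filter_upwards [(hmp k).quasiMeasurePreserving.ae hfC,
        hfst.quasiMeasurePreserving.ae hfC] with p h1 h2
      rw [norm_mul, Real.norm_of_nonneg (show (0:ℝ) ≤ (2 * C)⁻¹ by positivity)]
      refine mul_le_mul_of_nonneg_left ?_ (by positivity)
      exact (abs_sub _ _).trans (by linarith)
  rw [a1, ← integral_const_mul, ← integral_add j1 j2]
  refine integral_congr_ae ?_
  filter_upwards [aux_ae d] with p hp
  have hd := (aux_dist (ε k) (hεpos k) p.1 p.2 hp).trans hk.le
  by_cases hS : twoScale (ε k) p.1 p.2 ∈ Ω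
  · have b1 : twoScale (ε k) p.1 p.2 ∈ B := Metric.self_subset_cthickening _ hS
    have b2 : p.1 ∈ B := Metric.mem_cthickening_of_dist_le _ _ _ _ hS (by rwa [dist_comm])
    simp only [hf, indicator_of_mem b1, indicator_of_mem b2]
    field_simp
    ring
  · simp [hv0out k _ hS]
end
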